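/- arXiv:2004.05392 — 5 statements merged into one kernel-verified Lean document; each statement's English description precedes it below -/
import Mathlib

section
/- Let (X, ρ) be a bounded metric space, 0 ≤ q < 1, and (d_n)_{n∈ℕ} a sequence of self-maps d_n : X → X, each Lipschitz with constant q. Then the intersection ⋂_{n∈ℕ} range(d_0 ∘ d_1 ∘ ⋯ ∘ d_n) contains at most one point. -/
/-- The composite `d_0 ∘ d_1 ∘ ⋯ ∘ d_n` of the first `n + 1` maps of a sequence of
self-maps. -/
def compSeq {X : Type*} (d : ℕ → X → X) : ℕ → X → X
  | 0 => d 0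
  | n + 1 => compSeq d n ∘ d (n + 1)

theorem dist_compSeq_le {X : Type*} [PseudoMetricSpace X] {q : ℝ} (hq0 : 0 ≤ q)
    {d : ℕ → X → X} (hlip : ∀ n x y, dist (d n x) (d n y) ≤ q * dist x y) (n : ℕ) (x y : X) :
    dist (compSeq d n x) (compSeq d n y) ≤ q ^ (n + 1) * dist x y := by
  induction n generalizing x y with
  | zero => simpa [compSeq] using hlip 0 x y
  | succ n ih =>
    calc dist (compSeq d n (d (n + 1) x)) (compSeq d n (d (n + 1) y))
        ≤ q ^ (n + 1) * dist (d (n + 1) x) (d (n + 1) y) := ih _ _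
      _ ≤ q ^ (n + 1) * (q * dist x y) := by gcongr; exact hlip _ _ _
      _ = q ^ (n + 1 + 1) * dist x y := by ring

/-- Let `(X, ρ)` be a bounded metric space, `0 ≤ q < 1`, and `(d_n)` a sequence of
self-maps of `X`, each Lipschitz with constant `q`.  Then
`⋂_n range (d_0 ∘ d_1 ∘ ⋯ ∘ d_n)` contains at most one point. -/
theorem subsingleton_iInter_range_comp {X : Type*} [MetricSpace X]
    (M : ℝ) (hbdd : ∀ x y : X, dist x y ≤ M)
    (q : ℝ) (hq0 : 0 ≤ q) (hq1 : q < 1) (d : ℕ → X → X)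
    (hlip : ∀ n x y, dist (d n x) (d n y) ≤ q * dist x y) :
    Set.Subsingleton (⋂ n, Set.range (compSeq d n)) := by
  intro x hx y hy
  have h_le (n : ℕ) : dist x y ≤ q ^ (n + 1) * M := by
    obtain ⟨a, rfl⟩ := Set.mem_iInter.mp hx n
    obtain ⟨b, rfl⟩ := Set.mem_iInter.mp hy n
    exact (dist_compSeq_le hq0 hlip n a b).trans (by gcongr; exact hbdd a b)
  have h_lim : Filter.Tendsto (fun n : ℕ => q ^ (n + 1) * M) Filter.atTop (nhds 0) := by
    simpa using ((Filter.tendsto_add_atTop_iff_nat 1).mpr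
      (tendsto_pow_atTop_nhds_zero_of_lt_one hq0 hq1)).mul_const M
  exact dist_le_zero.mp (ge_of_tendsto' h_lim h_le)
end

section
/- Let X be a compact Hausdorff space and D a finite set of continuous unary self-maps of X with X = ⋃_{d∈D} range(d). Then for every nonempty compact subset K of X there exist a nonempty subset E = {e_1, …, e_r} of D and nonempty compact sets K_1, …, K_r ⊆ X such that K = ⋃_{κ=1}^r e_κ[K_κ]; consequently the hyperspace system (K(X), K(D)) is covering. -/
/-- Let `X` be a compact Hausdorff space and `D` a finite set of continuous unary self-maps
of `X` with `X = ⋃_{d ∈ D} range d`.  Then every nonempty compact `K ⊆ X` can be written as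
`K = ⋃_{e ∈ E} e[K_e]` for a nonempty subset `E ⊆ D` and nonempty compact sets `K_e ⊆ X`;
consequently the hyperspace system `(K(X), K(D))` is covering. -/
theorem hyperspace_covering {X : Type*} [TopologicalSpace X] [CompactSpace X] [T2Space X]
    [Nonempty X] (D : Set (X → X)) (hDfin : D.Finite)
    (hcont : ∀ d ∈ D, Continuous d)
    (hcov : ∀ x : X, ∃ d ∈ D, x ∈ Set.range d)
    (K : Set X) (hKne : K.Nonempty) (hK : IsCompact K) :
    ∃ E : Set (X → X), E ⊆ D ∧ E.Nonempty ∧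
      ∃ KK : (X → X) → Set X,
        (∀ e ∈ E, (KK e).Nonempty ∧ IsCompact (KK e)) ∧
        K = ⋃ e ∈ E, e '' KK e := by
  refine ⟨{d ∈ D | (d ⁻¹' K).Nonempty}, fun d hd => hd.1, ?_, fun d => d ⁻¹' K,
    fun e he => ⟨he.2, (hK.isClosed.preimage (hcont e he.1)).isCompact⟩, ?_⟩
  · obtain ⟨x, hx⟩ := hKne
    obtain ⟨d, hd, y, rfl⟩ := hcov x
    exact ⟨d, hd, y, hx⟩
  · refine Set.Subset.antisymm (fun x hx => ?_)
      (Set.iUnion₂_subset fun e _ => Set.image_preimage_subset e K)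
    obtain ⟨d, hd, y, rfl⟩ := hcov x
    exact Set.mem_biUnion (show d ∈ {d ∈ D | (d ⁻¹' K).Nonempty} from ⟨hd, y, hx⟩) ⟨y, hx, rfl⟩
end

section
/- Let (X, D), (Y, E) and (Z, C) be extended IFS. If f ∈ C_{F(Y,Z)} and g_1, …, g_{ar(f)} ∈ C_{F(X,Y)}, then f ∘ (g_1 × ⋯ × g_{ar(f)}) ∈ C_{F(X,Z)}, where g_1 × ⋯ × g_k : X^{ar(g_1)+⋯+ar(g_k)} → Y^k acts componentwise. -/
/-- An extended iterated function system on a space `X`: a finite set of continuous maps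
`d : X^{ar d} → X` of positive finite arity. -/
structure ExtIFS (X : Type*) [TopologicalSpace X] where
  /-- index type for the finitely many digit maps -/
  ι : Type
  fintype_ι : Fintype ι
  /-- the arity of each digit map -/
  ar : ι → ℕ
  ar_pos : ∀ i, 1 ≤ ar i
  /-- the digit maps `d : X^{ar d} → X` -/
  digit : (i : ι) → (Fin (ar i) → X) → X
  continuous_digit : ∀ i, Continuous (digit i)

/-- `F(X, Y)`: maps `f : X^m → Y` of some finite arity `m = ar f ≥ 0`. -/
def Fn (X Y : Type*) : Type _ := Σ m : ℕ, (Fin m → X) → Y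

theorem blockIdx_lt {k : ℕ} (m : Fin k → ℕ) (j : Fin k) (a : Fin (m j)) :
    (∑ i ∈ Finset.univ.filter (fun i => i < j), m i) + (a : ℕ) < ∑ i, m i := by
  have h1 : ∑ i, m i = (∑ i ∈ Finset.univ.filter (fun i => i < j), m i)
      + ∑ i ∈ Finset.univ.filter (fun i => ¬ i < j), m i :=
    (Finset.sum_filter_add_sum_filter_not _ _ _).symm
  have h2 : m j ≤ ∑ i ∈ Finset.univ.filter (fun i => ¬ i < j), m i :=
    Finset.single_le_sum (f := m) (fun i _ => Nat.zero_le _) (by simp)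
  have h3 := a.isLt
  omega

/-- The composition `e ∘ (f_1 × ⋯ × f_k) : X^{ar f_1 + ⋯ + ar f_k} → Z` of an outer map
`e : Y^k → Z` with a tuple of maps `f_j : X^{ar f_j} → Y` acting componentwise on blocks. -/
def compTuple {X Y Z : Type*} {k : ℕ} (e : (Fin k → Y) → Z) (fs : Fin k → Fn X Y) :
    Fn X Z :=
  ⟨∑ j, (fs j).1, fun v => e fun j => (fs j).2 fun a =>
    v ⟨(∑ i ∈ Finset.univ.filter (fun i => i < j), (fs i).1) + (a : ℕ),
      blockIdx_lt (fun i => (fs i).1) j a⟩⟩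

/-- `f ∘ d^{(i, ar f)} : X^{ar f + ar d − 1} → Y`, where
`d^{(i,m)}(x_1, …, x_{i−1}, y_1, …, y_{ar d}, x_{i+1}, …, x_m) =
 (x_1, …, x_{i−1}, d(y_1, …, y_{ar d}), x_{i+1}, …, x_m)`. -/
def precompDigit {X Y : Type*} (f : Fn X Y) (i : Fin f.1) {a : ℕ} (ha : 1 ≤ a)
    (d : (Fin a → X) → X) : Fn X Y :=
  ⟨f.1 + a - 1, fun v => f.2 fun k =>
    if h : (k : ℕ) < (i : ℕ) then
      v ⟨(k : ℕ), by have := k.isLt; omega⟩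
    else if h' : (k : ℕ) = (i : ℕ) then
      d fun b => v ⟨(i : ℕ) + (b : ℕ), by have := i.isLt; have := b.isLt; omega⟩
    else
      v ⟨(k : ℕ) + a - 1, by have := k.isLt; omega⟩⟩

variable {X Y : Type*} [TopologicalSpace X] [TopologicalSpace Y]

/-- The operator `Φ^{X,Y}(F)(G)`:  `f` belongs to it iff either `f = e ∘ (f_1 × ⋯ × f_{ar e})`
for a digit `e` of `Y` and maps `f_j ∈ F`, or for some argument position `i` of `f`,
`f ∘ d^{(i, ar f)} ∈ G` for every digit `d` of `X`. -/
def PhiFn (DX : ExtIFS X) (EY : ExtIFS Y) (F G : Set (Fn X Y)) : Set (Fn X Y) :=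
  {f | (∃ e : EY.ι, ∃ fs : Fin (EY.ar e) → Fn X Y, (∀ j, fs j ∈ F) ∧
          f = compTuple (EY.digit e) fs) ∨
       (∃ i : Fin f.1, ∀ d : DX.ι, precompDigit f i (DX.ar_pos d) (DX.digit d) ∈ G)}

/-- `Φ^{X,Y}(F)` as a monotone operator in `G`. -/
def PhiFnHom (DX : ExtIFS X) (EY : ExtIFS Y) (F : Set (Fn X Y)) :
    Set (Fn X Y) →o Set (Fn X Y) where
  toFun G := PhiFn DX EY F G
  monotone' := by
    intro G G' hGG' f hf
    rcases hf with h | ⟨i, hi⟩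
    · exact Or.inl h
    · exact Or.inr ⟨i, fun d => hGG' (hi d)⟩

/-- `J^{X,Y}(F) = μ Φ^{X,Y}(F)`, as a monotone operator in `F`. -/
def JFn (DX : ExtIFS X) (EY : ExtIFS Y) : Set (Fn X Y) →o Set (Fn X Y) where
  toFun F := OrderHom.lfp (PhiFnHom DX EY F)
  monotone' := by
    intro F F' hFF'
    apply OrderHom.lfp.monotone
    intro G f hf
    rcases hf with ⟨e, fs, hfs, hfeq⟩ | h
    · exact Or.inl ⟨e, fs, fun j => hFF' (hfs j), hfeq⟩
    · exact Or.inr h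

/-- `C_{F(X,Y)} = ν J^{X,Y}`, the co-inductively–inductively defined class of
(uniformly continuous) maps from `X` to `Y`. -/
def CFn (DX : ExtIFS X) (EY : ExtIFS Y) : Set (Fn X Y) := OrderHom.gfp (JFn DX EY)

/-- The sum of the first `j` entries of `m`, where `j` may be any natural number. -/
def prefixSum {k : ℕ} (m : Fin k → ℕ) (j : ℕ) : ℕ :=
  ∑ i ∈ Finset.range j, if h : i < k then m ⟨i, h⟩ else 0

@[simp]
theorem prefixSum_zero {k : ℕ} (m : Fin k → ℕ) : prefixSum m 0 = 0 := by
  simp [prefixSum]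

theorem prefixSum_succ {k : ℕ} (m : Fin k → ℕ) {j : ℕ} (h : j < k) :
    prefixSum m (j + 1) = prefixSum m j + m ⟨j, h⟩ := by
  simp [prefixSum, Finset.sum_range_succ, h]

theorem sum_univ_eq_prefixSum {k : ℕ} (m : Fin k → ℕ) : ∑ i, m i = prefixSum m k := by
  rw [prefixSum, Finset.sum_range]
  simp

theorem prefixSum_mono {k : ℕ} (m : Fin k → ℕ) : Monotone (prefixSum m) := fun _ _ h =>
  Finset.sum_le_sum_of_subset (Finset.range_mono h)

theorem sum_filter_lt_eq_prefixSum {k : ℕ} (m : Fin k → ℕ) (j : Fin k) :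
    ∑ i ∈ Finset.univ.filter (fun i => i < j), m i = prefixSum m j := by
  unfold prefixSum
  refine Finset.sum_bij (fun i _ => (i : ℕ)) ?_ ?_ ?_ ?_
  · intro i hi
    simpa using hi
  · intro i _ i' _ h
    exact Fin.ext h
  · intro b hb
    have hb' := Finset.mem_range.mp hb
    exact ⟨⟨b, hb'.trans j.isLt⟩, Finset.mem_filter.mpr ⟨Finset.mem_univ _, hb'⟩, rfl⟩
  · intro i _
    simp

theorem prefixSum_add_lt {k : ℕ} (m : Fin k → ℕ) (j : Fin k) {a : ℕ} (ha : a < m j) :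
    prefixSum m j + a < ∑ i, m i := by
  rw [← sum_filter_lt_eq_prefixSum]
  exact blockIdx_lt m j ⟨a, ha⟩

theorem prefixSum_prefixSum_add {k : ℕ} (m : Fin k → ℕ) (n : Fin (∑ i, m i) → ℕ) (j : Fin k)
    {a : ℕ} (ha : a ≤ m j) :
    prefixSum n (prefixSum m j + a) = prefixSum n (prefixSum m j) +
      prefixSum (fun b : Fin (m j) => n ⟨prefixSum m j + b, prefixSum_add_lt m j b.isLt⟩) a := by
  induction a with
  | zero => simp
  | succ a ih =>
    rw [prefixSum_succ _ ha, ← add_assoc, prefixSum_succ n (prefixSum_add_lt m j ha),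
      ih (by omega), add_assoc]

theorem prefixSum_sum_blocks {k : ℕ} (m : Fin k → ℕ) (n : Fin (∑ i, m i) → ℕ)
    {j : ℕ} (hj : j ≤ k) :
    prefixSum (fun i : Fin k =>
      ∑ b : Fin (m i), n ⟨prefixSum m i + b, prefixSum_add_lt m i b.isLt⟩) j =
      prefixSum n (prefixSum m j) := by
  induction j with
  | zero => simp
  | succ j ih =>
    rw [prefixSum_succ _ hj, ih (by omega), prefixSum_succ m hj]
    refine Eq.trans ?_ (prefixSum_prefixSum_add m n ⟨j, hj⟩ le_rfl).symm
    rw [← sum_univ_eq_prefixSum]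

theorem prefixSum_congr {k k' : ℕ} {m : Fin k → ℕ} {m' : Fin k' → ℕ} {j : ℕ}
    (hk : j ≤ k) (hk' : j ≤ k')
    (h : ∀ i (hi : i < j), m ⟨i, hi.trans_le hk⟩ = m' ⟨i, hi.trans_le hk'⟩) :
    prefixSum m j = prefixSum m' j := by
  refine Finset.sum_congr rfl fun i hi => ?_
  have hi := Finset.mem_range.mp hi
  rw [dif_pos (hi.trans_le hk), dif_pos (hi.trans_le hk'), h i hi]

theorem prefixSum_add_eq {k k' : ℕ} {m : Fin k → ℕ} {m' : Fin k' → ℕ} {s s' c t : ℕ}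
    (hk : s + c ≤ k) (hk' : s' + c ≤ k') (h0 : prefixSum m s = prefixSum m' s' + t)
    (h : ∀ i (hi : i < c), m ⟨s + i, by omega⟩ = m' ⟨s' + i, by omega⟩) :
    prefixSum m (s + c) = prefixSum m' (s' + c) + t := by
  induction c with
  | zero => simpa using h0
  | succ c ih =>
    rw [← add_assoc, ← add_assoc, prefixSum_succ m (by omega), prefixSum_succ m' (by omega),
      ih (by omega) (by omega) fun i hi => h i (by omega), h c (by omega)]
    omega

namespace Fn

/-- Evaluate a map of finite arity at an initial segment of a sequence. -/
def eval {X Y : Type*} (f : Fn X Y) (w : ℕ → X) : Y := f.2 fun i => w i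

theorem ext_eval {X Y : Type*} [Nonempty X] {f g : Fn X Y} (h : f.1 = g.1)
    (hw : ∀ w, f.eval w = g.eval w) : f = g := by
  obtain ⟨m, f⟩ := f
  obtain ⟨n, g⟩ := g
  obtain rfl : m = n := h
  congr 1
  funext v
  have := hw fun i => if hi : i < m then v ⟨i, hi⟩ else Classical.arbitrary X
  simpa [eval] using this

theorem eval_congr {X Y : Type*} (f : Fn X Y) {w w' : ℕ → X} (h : ∀ i < f.1, w i = w' i) :
    f.eval w = f.eval w' :=
  congrArg f.2 (funext fun i => h i i.isLt)

end Fn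

section

variable {X Y Z : Type*}

theorem compTuple_fst {k : ℕ} (e : (Fin k → Y) → Z) (fs : Fin k → Fn X Y) :
    (compTuple e fs).1 = prefixSum (fun i => (fs i).1) k :=
  sum_univ_eq_prefixSum _

theorem eval_compTuple {k : ℕ} (e : (Fin k → Y) → Z) (fs : Fin k → Fn X Y) (w : ℕ → X) :
    (compTuple e fs).eval w =
      e fun j => (fs j).eval fun a => w (prefixSum (fun i => (fs i).1) j + a) := by
  simp only [← sum_filter_lt_eq_prefixSum]
  rfl

theorem compTuple_snd {k : ℕ} (e : (Fin k → Y) → Z) (fs : Fin k → Fn X Y)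
    (v : Fin (compTuple e fs).1 → X) :
    (compTuple e fs).2 v = e fun j => (fs j).2 fun a =>
      v ⟨prefixSum (fun i => (fs i).1) j + a, prefixSum_add_lt _ j a.isLt⟩ := by
  simp only [← sum_filter_lt_eq_prefixSum]
  rfl

theorem eval_precompDigit (f : Fn X Y) (i : Fin f.1) {a : ℕ} (ha : 1 ≤ a)
    (d : (Fin a → X) → X) (w : ℕ → X) :
    (precompDigit f i ha d).eval w = f.eval fun k =>
      if k < (i : ℕ) then w k else if k = (i : ℕ) then d fun b => w (i + b)
      else w (k + a - 1) := by
  simp only [Fn.eval, precompDigit, dite_eq_ite]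

/-- Associativity of composition with tuples. -/
theorem compTuple_compTuple {W : Type*} [Nonempty X] {k : ℕ} (e : (Fin k → Z) → W)
    (fs : Fin k → Fn Y Z) (g : Fin (compTuple e fs).1 → Fn X Y) :
    compTuple (compTuple e fs).2 g = compTuple e fun j => compTuple (fs j).2 fun a =>
      g ⟨prefixSum (fun i => (fs i).1) j + a, prefixSum_add_lt _ j a.isLt⟩ := by
  have key := fun (j : ℕ) (hj : j ≤ k) =>
    prefixSum_sum_blocks (fun i => (fs i).1) (fun i => (g i).1) hj
  refine Fn.ext_eval ?_ fun w => ?_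
  · refine (compTuple_fst _ _).trans (Eq.trans ?_ (compTuple_fst _ _).symm)
    refine Eq.trans ?_ (key k le_rfl).symm
    exact congrArg (prefixSum fun i => (g i).1) (compTuple_fst e fs)
  · rw [eval_compTuple, eval_compTuple, compTuple_snd]
    congr 1
    funext j
    rw [eval_compTuple]
    refine congrArg (fs j).2 (funext fun a => ?_)
    refine congrArg _ (funext fun b => congrArg w ?_)
    have h1 := prefixSum_prefixSum_add (fun i => (fs i).1) (fun i => (g i).1) j a.isLt.le
    have h2 := key j j.isLt.le
    refine Eq.trans (congrArg (· + b) h1) ?_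
    rw [← h2, add_assoc]
    rfl

/-- Precomposing a composition with a digit at a position inside the `i`-th block amounts to
precomposing the `i`-th component. -/
theorem precompDigit_compTuple [Nonempty X] {k : ℕ} (e : (Fin k → Y) → Z) (g : Fin k → Fn X Y)
    (i : Fin k) (l : Fin (g i).1) {a : ℕ} (ha : 1 ≤ a) (d : (Fin a → X) → X) :
    precompDigit (compTuple e g)
      ⟨prefixSum (fun i => (g i).1) i + l, prefixSum_add_lt _ i l.isLt⟩ ha d =
      compTuple e (Function.update g i (precompDigit (g i) l ha d)) := by
  set g' := Function.update g i (precompDigit (g i) l ha d)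
  have hgi : g' i = precompDigit (g i) l ha d := by simp [g']
  have hgi1 : (g' i).1 = (g i).1 + a - 1 := by rw [hgi]; rfl
  have hgj : ∀ j, j ≠ i → g' j = g j := fun j hj => by simp [g', hj]
  have low : ∀ j ≤ (i : ℕ), prefixSum (fun j => (g' j).1) j = prefixSum (fun j => (g j).1) j :=
    fun j hj => prefixSum_congr (by omega) (by omega) fun b hb => by
      rw [hgj _ (by rw [Ne, Fin.ext_iff]; simp; omega)]
  have hl := l.isLt
  have hsucc : prefixSum (fun j => (g' j).1) (i + 1) =
      prefixSum (fun j => (g j).1) (i + 1) + (a - 1) := by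
    rw [prefixSum_succ _ i.isLt, prefixSum_succ _ i.isLt, low _ le_rfl]
    simp only [Fin.eta]
    omega
  have high : ∀ j, (i : ℕ) < j → j ≤ k → prefixSum (fun j => (g' j).1) j =
      prefixSum (fun j => (g j).1) j + (a - 1) := by
    intro j hj hjk
    obtain ⟨c, rfl⟩ := Nat.exists_eq_add_of_le (Nat.succ_le_of_lt hj)
    exact prefixSum_add_eq hjk hjk hsucc fun b hb => by
      rw [hgj _ (by rw [Ne, Fin.ext_iff]; simp; omega)]
  refine Fn.ext_eval ?_ fun w => ?_
  · have h1 := high k i.isLt le_rfl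
    have h2 := compTuple_fst e g
    have h3 := compTuple_fst e g'
    change (compTuple e g).1 + a - 1 = _
    omega
  · rw [eval_precompDigit, eval_compTuple, eval_compTuple]
    congr 1
    funext j
    dsimp only
    rcases lt_trichotomy j i with hj | rfl | hj
    · rw [hgj j hj.ne, low j hj.le]
      refine Fn.eval_congr _ fun b hb => if_pos ?_
      have h1 := prefixSum_mono (fun i => (g i).1) (Nat.succ_le_of_lt hj)
      rw [Nat.succ_eq_add_one, prefixSum_succ _ j.isLt] at h1
      simp only [Fin.eta] at h1
      omega
    · rw [hgi, low _ le_rfl, eval_precompDigit]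
      refine Fn.eval_congr _ fun b hb => ?_
      simp only [add_lt_add_iff_left, add_right_inj, add_assoc]
      congr 3
      omega
    · rw [hgj j hj.ne', high j hj j.isLt.le]
      refine Fn.eval_congr _ fun b hb => ?_
      have h1 := prefixSum_mono (fun i => (g i).1) (Nat.succ_le_of_lt hj)
      rw [Nat.succ_eq_add_one, prefixSum_succ _ i.isLt] at h1
      simp only [Fin.eta] at h1
      rw [if_neg (by omega), if_neg (by omega)]
      congr 1
      omega

/-- Replace the `i`-th entry of the tuple `g` by the tuple `h`. -/
def spliceTuple {α : Type*} {k a : ℕ} (g : Fin k → α) (i : Fin k) (h : Fin a → α) :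
    Fin (k + a - 1) → α := fun j =>
  if h1 : (j : ℕ) < i then g ⟨j, h1.trans i.isLt⟩
  else if h2 : (j : ℕ) < i + a then h ⟨j - i, by omega⟩
  else g ⟨j + 1 - a, by omega⟩

/-- If the `i`-th component emits a digit `d`, this digit can be absorbed by the outer map. -/
theorem compTuple_eq_compTuple_precompDigit [Nonempty X] (f : Fn Y Z) (g : Fin f.1 → Fn X Y)
    (i : Fin f.1) {a : ℕ} (ha : 1 ≤ a) (d : (Fin a → Y) → Y) (h : Fin a → Fn X Y)
    (hgi : g i = compTuple d h) :
    compTuple f.2 g = compTuple (precompDigit f i ha d).2 (spliceTuple g i h) := by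
  have hi := i.isLt
  set g' := spliceTuple g i h
  have glow : ∀ j (hj : j < (i : ℕ)), g' ⟨j, by omega⟩ = g ⟨j, by omega⟩ := fun j hj => by
    simp [g', spliceTuple, hj]
  have gmid : ∀ b (hb : b < a), g' ⟨i + b, by omega⟩ = h ⟨b, hb⟩ := fun b hb => by
    simp [g', spliceTuple, hb]
  have ghigh : ∀ c (hc : i + 1 + c < f.1),
      g' ⟨i + a + c, by omega⟩ = g ⟨i + 1 + c, hc⟩ := fun c hc => by
    simp only [g', spliceTuple]
    rw [dif_neg (by omega), dif_neg (by omega)]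
    congr 2
    omega
  have low : ∀ j ≤ (i : ℕ), prefixSum (fun j => (g' j).1) j = prefixSum (fun j => (g j).1) j :=
    fun j hj => prefixSum_congr (by omega) (by omega) fun b hb => by
      rw [glow b (by omega)]
  have mid : ∀ b ≤ a, prefixSum (fun j => (g' j).1) (i + b) =
      prefixSum (fun j => (g j).1) i + prefixSum (fun j => (h j).1) b := fun b hb => by
    have h1 := prefixSum_add_eq (m := fun j => (g' j).1) (m' := fun j => (h j).1)
      (s := i) (s' := 0) (c := b) (t := prefixSum (fun j => (g j).1) i) (by omega) (by omega)
      (by rw [low _ le_rfl]; simp) (fun c hc => by rw [gmid c (by omega)]; simp)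
    rw [h1, zero_add, add_comm]
  have high : ∀ c, i + 1 + c ≤ f.1 → prefixSum (fun j => (g' j).1) (i + a + c) =
      prefixSum (fun j => (g j).1) (i + 1 + c) := fun c hc =>
    prefixSum_add_eq (m := fun j => (g' j).1) (m' := fun j => (g j).1) (t := 0) (by omega) (by omega)
      (by
        rw [mid a le_rfl, prefixSum_succ _ i.isLt]
        simp only [Fin.eta]
        rw [hgi, compTuple_fst, add_zero])
      (fun b hb => by rw [ghigh b (by omega)])
  refine Fn.ext_eval ?_ fun w => ?_
  · refine (compTuple_fst _ _).trans
      (Eq.trans ?_ (compTuple_fst (k := f.1 + a - 1) (precompDigit f i ha d).2 g').symm)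
    have h1 := high (f.1 - (i + 1)) (by omega)
    rw [show i + 1 + (f.1 - (i + 1)) = f.1 by omega] at h1
    rw [← h1]
    congr 1
    omega
  · refine (eval_compTuple _ _ w).trans
      (Eq.trans ?_ (eval_compTuple (k := f.1 + a - 1) (precompDigit f i ha d).2 g' w).symm)
    refine congrArg f.2 (funext fun j => ?_)
    have hj := j.isLt
    split_ifs with h1 h2
    · beta_reduce
      rw [low j h1.le, glow j h1]
    · obtain rfl : j = i := Fin.ext h2
      rw [hgi, eval_compTuple]
      congr 1
      funext b
      beta_reduce
      rw [gmid b b.isLt, mid b b.isLt.le]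
      simp only [add_assoc, Fin.eta]
    · obtain ⟨c, hc⟩ := Nat.exists_eq_add_of_le (show (i : ℕ) + 1 ≤ j by omega)
      have h3 : (j : ℕ) + a - 1 = i + a + c := by omega
      have h4 := ghigh c (by omega)
      simp only [h3]
      rw [h4, high c (by omega)]
      simp only [← hc, Fin.eta]

end

theorem spliceTuple_mem {α : Type*} {S : Set α} {k a : ℕ} {g : Fin k → α} (i : Fin k)
    {h : Fin a → α} (hg : ∀ j, g j ∈ S) (hh : ∀ j, h j ∈ S) (j : Fin (k + a - 1)) :
    spliceTuple g i h j ∈ S := by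
  unfold spliceTuple
  split_ifs
  · exact hg _
  · exact hh _
  · exact hg _

section

variable {DX : ExtIFS X} {EY : ExtIFS Y}

theorem PhiFn_JFn (F : Set (Fn X Y)) : PhiFn DX EY F (JFn DX EY F) = JFn DX EY F :=
  (PhiFnHom DX EY F).map_lfp

theorem JFn_CFn : JFn DX EY (CFn DX EY) = CFn DX EY :=
  (JFn DX EY).map_gfp

theorem subset_CFn {F : Set (Fn X Y)} (h : F ⊆ JFn DX EY F) : F ⊆ CFn DX EY :=
  (JFn DX EY).le_gfp h

/-- Induction on membership in `C_{F(X,Y)}`, seen as the least fixed point of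
`Φ^{X,Y}(C_{F(X,Y)})`. -/
theorem CFn_induction {P : Fn X Y → Prop}
    (emit : ∀ (e : EY.ι) (fs : Fin (EY.ar e) → Fn X Y), (∀ j, fs j ∈ CFn DX EY) →
      P (compTuple (EY.digit e) fs))
    (absorb : ∀ (f : Fn X Y) (i : Fin f.1),
      (∀ d : DX.ι, precompDigit f i (DX.ar_pos d) (DX.digit d) ∈ CFn DX EY) →
      (∀ d : DX.ι, P (precompDigit f i (DX.ar_pos d) (DX.digit d))) → P f)
    {f : Fn X Y} (hf : f ∈ CFn DX EY) : P f := by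
  have h : JFn DX EY (CFn DX EY) ≤ {f | f ∈ CFn DX EY ∧ P f} := by
    refine (PhiFnHom DX EY (CFn DX EY)).lfp_le ?_
    intro f hf
    refine ⟨?_, ?_⟩
    · rw [← JFn_CFn, ← PhiFn_JFn, JFn_CFn]
      exact (PhiFnHom DX EY (CFn DX EY)).monotone (fun _ h => h.1) hf
    · rcases hf with ⟨e, fs, hfs, rfl⟩ | ⟨i, hi⟩
      · exact emit e fs hfs
      · exact absorb f i (fun d => (hi d).1) fun d => (hi d).2
  rw [← JFn_CFn] at hf
  exact (h hf).2

end

/-- Let `(X, D)`, `(Y, E)` and `(Z, C)` be extended IFS.  If `f ∈ C_{F(Y,Z)}` and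
`g_1, …, g_{ar f} ∈ C_{F(X,Y)}`, then `f ∘ (g_1 × ⋯ × g_{ar f}) ∈ C_{F(X,Z)}`. -/
theorem CFn_comp {X Y Z : Type*} [TopologicalSpace X] [TopologicalSpace Y]
    [TopologicalSpace Z] [T2Space X] [T2Space Y] [T2Space Z]
    [Nonempty X] [Nonempty Y] [Nonempty Z]
    (DX : ExtIFS X) (EY : ExtIFS Y) (CZ : ExtIFS Z)
    (f : Fn Y Z) (hf : f ∈ CFn EY CZ)
    (g : Fin f.1 → Fn X Y) (hg : ∀ j, g j ∈ CFn DX EY) :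
    compTuple f.2 g ∈ CFn DX CZ := by
  let R : Set (Fn X Z) := {p | ∃ f ∈ CFn EY CZ, ∃ g : Fin f.1 → Fn X Y,
    (∀ j, g j ∈ CFn DX EY) ∧ p = compTuple f.2 g}
  refine subset_CFn (F := R) ?_ ⟨f, hf, g, hg, rfl⟩
  rintro _ ⟨f, hf, g, hg, rfl⟩
  revert g
  refine CFn_induction (P := fun f => ∀ g : Fin f.1 → Fn X Y, (∀ j, g j ∈ CFn DX EY) →
    compTuple f.2 g ∈ JFn DX CZ R) ?_ ?_ hf
  · intro e fs hfs g hg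
    rw [compTuple_compTuple, ← PhiFn_JFn]
    exact Or.inl ⟨e, _, fun j => ⟨fs j, hfs j, _, fun a => hg _, rfl⟩, rfl⟩
  · intro f i _ ih g hg
    refine CFn_induction (P := fun h => ∀ g : Fin f.1 → Fn X Y, (∀ j, g j ∈ CFn DX EY) →
      g i = h → compTuple f.2 g ∈ JFn DX CZ R) ?_ ?_ (hg i) g hg rfl
    · intro e hs hhs g hg hgi
      rw [compTuple_eq_compTuple_precompDigit f g i (EY.ar_pos e) (EY.digit e) hs hgi]
      exact ih e _ (spliceTuple_mem i hg hhs)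
    · rintro _ l hl ihl g hg rfl
      rw [← PhiFn_JFn]
      refine Or.inr ⟨⟨prefixSum (fun i => (g i).1) i + l, prefixSum_add_lt _ i l.isLt⟩,
        fun d => ?_⟩
      rw [precompDigit_compTuple]
      refine ihl d _ (fun j => ?_) (Function.update_self ..)
      rcases eq_or_ne j i with rfl | hj
      · rw [Function.update_self]
        exact hl d
      · rw [Function.update_of_ne hj]
        exact hg j
end

section
/- Let (X, D) and (Y, E) be extended IFS, and let m ∈ ℕ. If f ∈ C_{F(X,Y)} has arity m and x_1, …, x_m ∈ C_X, then f(x_1, …, x_m) ∈ C_Y; that is, evaluation maps C_{F(X,Y)}^{(m)} × C_X^m into C_Y. -/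
variable {X Y : Type*} [TopologicalSpace X] [TopologicalSpace Y]

/-- The monotone operator `Φ_X` on the powerset of `X` whose greatest fixed point is
`C_X`:  `Φ_X(Z) = { x | ∃ d ∈ D, ∃ y_1, …, y_{ar d} ∈ Z, x = d(y_1, …, y_{ar d}) }`. -/
def PhiSet {X : Type*} [TopologicalSpace X] (S : ExtIFS X) : Set X →o Set X where
  toFun Z := {x : X | ∃ i : S.ι, ∃ y : Fin (S.ar i) → X, (∀ κ, y κ ∈ Z) ∧ x = S.digit i y}
  monotone' := by
    intro Z Z' hZZ' x hx
    obtain ⟨i, y, hy, hxy⟩ := hx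
    exact ⟨i, y, fun κ => hZZ' (hy κ), hxy⟩

/-- `C_X`, the greatest fixed point of `Φ_X`. -/
def CSet {X : Type*} [TopologicalSpace X] (S : ExtIFS X) : Set X :=
  OrderHom.gfp (PhiSet S)

theorem precompDigit_splice {X Y : Type*} (f : Fn X Y) (i : Fin f.1) {a : ℕ} (ha : 1 ≤ a)
    (d : (Fin a → X) → X) (x : Fin f.1 → X) (y : Fin a → X) (hxy : x i = d y)
    {S : Set X} (hx : ∀ κ, x κ ∈ S) (hy : ∀ κ, y κ ∈ S) :
    ∃ v : Fin (precompDigit f i ha d).1 → X,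
      (∀ κ, v κ ∈ S) ∧ (precompDigit f i ha d).2 v = f.2 x := by
  have hi := i.isLt
  let v : Fin (f.1 + a - 1) → X := fun k =>
    if h : (k : ℕ) < i then x ⟨k, by omega⟩
    else if h' : (k : ℕ) < i + a then y ⟨k - i, by omega⟩
    else x ⟨k + 1 - a, by have := k.isLt; omega⟩
  refine ⟨v, fun κ => ?_, ?_⟩
  · simp only [v]
    split_ifs
    exacts [hx _, hy _, hx _]
  · change f.2 _ = f.2 x
    refine congrArg f.2 (funext fun k => ?_)
    split_ifs with h h'
    · simp [v, h]
    · obtain rfl : k = i := Fin.ext h'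
      simp [v, hxy]
    · have h₁ : ¬ (k : ℕ) + a - 1 < i := by omega
      have h₂ : ¬ (k : ℕ) + a - 1 < i + a := by omega
      have h₃ : (k : ℕ) + a - 1 + 1 - a = k := by omega
      simp [v, h₁, h₂, h₃]

theorem CFn_subset_eval_mem_PhiSet {X Y : Type*} [TopologicalSpace X] [TopologicalSpace Y]
    (DX : ExtIFS X) (EY : ExtIFS Y) :
    CFn DX EY ⊆ {f | ∀ x : Fin f.1 → X, (∀ κ, x κ ∈ CSet DX) → f.2 x ∈ PhiSet EY
      {y | ∃ g ∈ CFn DX EY, ∃ x : Fin g.1 → X, (∀ κ, x κ ∈ CSet DX) ∧ g.2 x = y}} := by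
  have hfix : CFn DX EY = OrderHom.lfp (PhiFnHom DX EY (CFn DX EY)) :=
    (OrderHom.map_gfp (JFn DX EY)).symm
  refine hfix.le.trans (OrderHom.lfp_le _ ?_)
  rintro f (⟨e, fs, hfs, rfl⟩ | ⟨i, hi⟩) x hx
  · exact ⟨e, _, fun j => ⟨fs j, hfs j, _, fun a => hx _, rfl⟩, rfl⟩
  · have hxi : x i ∈ PhiSet DX (CSet DX) := (OrderHom.map_gfp (PhiSet DX)).ge (hx i)
    obtain ⟨d, y, hy, hxy⟩ := hxi
    obtain ⟨v, hv, hfv⟩ := precompDigit_splice f i (DX.ar_pos d) (DX.digit d) x y hxy hx hy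
    rw [← hfv]
    exact hi d v hv

/-- Let `(X, D)` and `(Y, E)` be extended IFS.  If `f ∈ C_{F(X,Y)}` has arity `m` and
`x_1, …, x_m ∈ C_X`, then `f (x_1, …, x_m) ∈ C_Y`: evaluation maps
`C_{F(X,Y)}^{(m)} × C_X^m` into `C_Y`. -/
theorem CFn_eval {X Y : Type*} [TopologicalSpace X] [TopologicalSpace Y]
    [T2Space X] [T2Space Y] [Nonempty X] [Nonempty Y]
    (DX : ExtIFS X) (EY : ExtIFS Y) (m : ℕ)
    (f : Fn X Y) (harf : f.1 = m) (hf : f ∈ CFn DX EY)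
    (x : Fin f.1 → X) (hx : ∀ κ, x κ ∈ CSet DX) :
    f.2 x ∈ CSet EY := by
  refine OrderHom.le_gfp (PhiSet EY) (a :=
    {y | ∃ g ∈ CFn DX EY, ∃ x : Fin g.1 → X, (∀ κ, x κ ∈ CSet DX) ∧ g.2 x = y}) ?_
    ⟨f, hf, x, hx, rfl⟩
  rintro _ ⟨g, hg, z, hz, rfl⟩
  exact CFn_subset_eval_mem_PhiSet DX EY hg z hz
end

section
/- Let (X, D) be a compact IFS with all digits unary. Then C_{K(X)} is closed under binary unions: for all K, M ∈ K(X), if K ∈ C_{K(X)} and M ∈ C_{K(X)}, then K ∪ M ∈ C_{K(X)}. -/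
/-- The monotone operator `Ω` on the powerset of `K(X)`:
`Ω(𝒵) = { K ∈ K(X) | ∃ r ≥ 1, ∃ pairwise distinct d_1, …, d_r ∈ D,
∃ K_1, …, K_r ∈ 𝒵, K = ⋃_κ d_κ[K_κ] }`.  Its greatest fixed point is `C_{K(X)}`. -/
def OmegaK {X : Type*} [TopologicalSpace X] (D : Set (X → X)) :
    Set (Set X) →o Set (Set X) where
  toFun 𝒵 := {K : Set X | K.Nonempty ∧ IsCompact K ∧
    ∃ r : ℕ, 1 ≤ r ∧ ∃ d : Fin r → X → X, Function.Injective d ∧ (∀ κ, d κ ∈ D) ∧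
      ∃ KK : Fin r → Set X, (∀ κ, KK κ ∈ 𝒵) ∧ K = ⋃ κ, d κ '' KK κ}
  monotone' := by
    intro 𝒵 𝒵' h K hK
    obtain ⟨h1, h2, r, hr, d, hinj, hd, KK, hKK, hEq⟩ := hK
    exact ⟨h1, h2, r, hr, d, hinj, hd, KK, fun κ => h (hKK κ), hEq⟩

/-- Membership in `OmegaK D 𝒵`, indexed by a finite set of digits instead of an injective tuple. -/
theorem mem_OmegaK_iff {X : Type*} [TopologicalSpace X] {D : Set (X → X)} {𝒵 : Set (Set X)}
    {K : Set X} :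
    K ∈ OmegaK D 𝒵 ↔ K.Nonempty ∧ IsCompact K ∧ ∃ S : Finset (X → X), S.Nonempty ∧ ↑S ⊆ D ∧
      ∃ F : (X → X) → Set X, (∀ f ∈ S, F f ∈ 𝒵) ∧ K = ⋃ f ∈ S, f '' F f := by
  classical
  constructor
  · rintro ⟨hne, hcomp, r, hr, d, hinj, hd, KK, hKK, rfl⟩
    refine ⟨hne, hcomp, Finset.univ.image d, ?_, ?_, Function.extend d KK fun _ => ∅, ?_, ?_⟩
    · exact ⟨d ⟨0, hr⟩, Finset.mem_image_of_mem d (Finset.mem_univ _)⟩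
    · simpa [Set.range_subset_iff] using hd
    · simpa [hinj.extend_apply] using hKK
    · simp [hinj.extend_apply]
  · rintro ⟨hne, hcomp, S, hS, hSD, F, hF, rfl⟩
    refine ⟨hne, hcomp, S.card, hS.card_pos, fun κ => S.equivFin.symm κ,
      Subtype.val_injective.comp S.equivFin.symm.injective,
      fun κ => hSD (S.equivFin.symm κ).2, fun κ => F (S.equivFin.symm κ),
      fun κ => hF _ (S.equivFin.symm κ).2, ?_⟩
    rw [S.equivFin.symm.surjective.iUnion_comp (fun f : S => (f : X → X) '' F f)]
    exact Set.biUnion_eq_iUnion _ _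

/-- If `𝒲` contains all members of `𝒵` and all their binary unions, then binary unions of members
of `OmegaK D 𝒵` belong to `OmegaK D 𝒲`. -/
theorem union_mem_OmegaK {X : Type*} [TopologicalSpace X] {D : Set (X → X)}
    {𝒵 𝒲 : Set (Set X)} (hsub : 𝒵 ⊆ 𝒲) (hunion : ∀ A ∈ 𝒵, ∀ B ∈ 𝒵, A ∪ B ∈ 𝒲)
    {K M : Set X} (hK : K ∈ OmegaK D 𝒵) (hM : M ∈ OmegaK D 𝒵) : K ∪ M ∈ OmegaK D 𝒲 := by
  classical
  rw [mem_OmegaK_iff] at *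
  obtain ⟨hKne, hKc, S, hS, hSD, F, hF, hKeq⟩ := hK
  obtain ⟨-, hMc, T, -, hTD, G, hG, hMeq⟩ := hM
  refine ⟨hKne.inl, hKc.union hMc, S ∪ T, hS.inl, by simp [hSD, hTD],
    fun f => (if f ∈ S then F f else ∅) ∪ (if f ∈ T then G f else ∅), fun f hf => ?_, ?_⟩
  · by_cases h₁ : f ∈ S <;> by_cases h₂ : f ∈ T
    · simpa [h₁, h₂] using hunion _ (hF f h₁) _ (hG f h₂)
    · simpa [h₁, h₂] using hsub (hF f h₁)
    · simpa [h₁, h₂] using hsub (hG f h₂)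
    · simp [h₁, h₂] at hf
  · rw [hKeq, hMeq]
    ext x
    simp only [Set.mem_union, Set.mem_iUnion, Set.mem_image, Finset.mem_union,
      Set.mem_ite_empty_right]
    clear * -
    grind

/-- Let `(X, D)` be a compact IFS with unary digits.  Then `C_{K(X)}` is closed under
binary unions: for `K, M ∈ K(X)`, if `K ∈ C_{K(X)}` and `M ∈ C_{K(X)}` then
`K ∪ M ∈ C_{K(X)}`. -/
theorem union_mem_CK {X : Type*} [TopologicalSpace X] [CompactSpace X] [T2Space X]
    [Nonempty X] (D : Set (X → X)) (hDfin : D.Finite) (hcont : ∀ d ∈ D, Continuous d)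
    (K M : Set X)
    (hK : K ∈ OrderHom.gfp (OmegaK D)) (hM : M ∈ OrderHom.gfp (OmegaK D)) :
    K ∪ M ∈ OrderHom.gfp (OmegaK D) := by
  let 𝒞 := OrderHom.gfp (OmegaK D)
  have hfix : OmegaK D 𝒞 = 𝒞 := OrderHom.map_gfp _
  let 𝒲 : Set (Set X) := {L | ∃ A ∈ 𝒞, ∃ B ∈ 𝒞, L = A ∪ B}
  have hpost : 𝒲 ≤ OmegaK D 𝒲 := by
    rintro _ ⟨A, hA, B, hB, rfl⟩
    rw [← hfix] at hA hB
    exact union_mem_OmegaK (𝒵 := 𝒞) (𝒲 := 𝒲) (fun A hA => ⟨A, hA, A, hA, (Set.union_self A).symm⟩)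
      (fun A hA B hB => ⟨A, hA, B, hB, rfl⟩) hA hB
  exact OrderHom.le_gfp _ hpost ⟨K, hK, M, hM, rfl⟩
end
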